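/- For the two-dimensional Ising model on the periodic L_1 × L_2 square lattice with ferromagnetic couplings a, b > 0, if L_1 = 2^k n for some positive integer k, then the two-point function of two spins at distance n along the first lattice direction satisfies ⟨σ_{(0,0)} σ_{(n,0)}⟩_Λ ≤ 2 { (1/2)(1 − Z_Λ^(−)/Z_Λ) }^{n/L_1}. -/

import Mathlib

/-!
The two-dimensional Ising model on the periodic `L1 × L2` square lattice.
Spins `σ_x = ±1` are encoded by `Bool` via `spinv`; `cyc i j` is cyclic translation of
`i : Fin m` by `j` steps.  `ZI` is the periodic partition function with horizontal
coupling `a` and vertical coupling `b` (including the normalization `2^{-L1 L2}` of the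
counting measure); `ZIm` is the partition function with the sign of the horizontal
coupling reversed on all horizontal links of the fixed column crossing the boundary
(i.e. antiperiodic boundary conditions in the first direction); `corrI` is the
two-point function `⟨σ_x σ_y⟩_Λ`.
-/

namespace TYIsing

/-- Cyclic shift on `Fin m` by `j` steps. -/
def cyc {m : ℕ} (i : Fin m) (j : ℕ) : Fin m := ⟨(i.val + j) % m, Nat.mod_lt _ i.pos⟩

/-- The Ising spin value `±1` encoded by a Boolean. -/
def spinv (s : Bool) : ℝ := if s then 1 else -1

/-- Periodic Ising partition function on the `L1 × L2` torus. -/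
noncomputable def ZI (L1 L2 : ℕ) (a b : ℝ) : ℝ :=
  ∑ σ : Fin L1 × Fin L2 → Bool, ((2 : ℝ)⁻¹) ^ (L1 * L2) *
    Real.exp (∑ x : Fin L1 × Fin L2,
      (a * spinv (σ x) * spinv (σ (cyc x.1 1, x.2)) +
        b * spinv (σ x) * spinv (σ (x.1, cyc x.2 1))))

/-- Twisted (antiperiodic in the first direction) Ising partition function:
the coupling `a` is reversed in sign on the horizontal links of the column crossing
the boundary. -/
noncomputable def ZIm (L1 L2 : ℕ) (a b : ℝ) : ℝ :=
  ∑ σ : Fin L1 × Fin L2 → Bool, ((2 : ℝ)⁻¹) ^ (L1 * L2) *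
    Real.exp (∑ x : Fin L1 × Fin L2,
      ((if x.1.val + 1 = L1 then -a else a) * spinv (σ x) * spinv (σ (cyc x.1 1, x.2)) +
        b * spinv (σ x) * spinv (σ (x.1, cyc x.2 1))))

/-- The finite-volume two-point function `⟨σ_x σ_y⟩_Λ`. -/
noncomputable def corrI (L1 L2 : ℕ) (a b : ℝ) (x y : Fin L1 × Fin L2) : ℝ :=
  (∑ σ : Fin L1 × Fin L2 → Bool, ((2 : ℝ)⁻¹) ^ (L1 * L2) * spinv (σ x) * spinv (σ y) *
      Real.exp (∑ w : Fin L1 × Fin L2,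
        (a * spinv (σ w) * spinv (σ (cyc w.1 1, w.2)) +
          b * spinv (σ w) * spinv (σ (w.1, cyc w.2 1))))) / ZI L1 L2 a b

end TYIsing

namespace TYIsing

open Matrix

section MatrixInequalities

/-- Hölder's inequality for sums weighted by a doubly stochastic kernel. -/
lemma sum_mul_pow_mul_pow_le {ι : Type*} [Fintype ι] (w : ι → ι → ℝ) (hw : ∀ i j, 0 ≤ w i j)
    (hrow : ∀ i, ∑ j, w i j = 1) (hcol : ∀ j, ∑ i, w i j = 1)
    (d e : ι → ℝ) (hd : ∀ i, 0 ≤ d i) (he : ∀ j, 0 ≤ e j) {m n : ℕ} (hm : 0 < m) (hn : 0 < n) :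
    ∑ i, ∑ j, w i j * d i ^ m * e j ^ n ≤
      (∑ i, d i ^ (m + n)) ^ ((m : ℝ) / (m + n : ℕ)) *
        (∑ j, e j ^ (m + n)) ^ ((n : ℝ) / (m + n : ℕ)) := by
  have hm' : (0 : ℝ) < m := by exact_mod_cast hm
  have hn' : (0 : ℝ) < n := by exact_mod_cast hn
  have hL : (0 : ℝ) < (m + n : ℕ) := by positivity
  have hpq : ((m + n : ℕ) / (m : ℝ)).HolderConjugate ((m + n : ℕ) / (n : ℝ)) := by
    rw [Real.holderConjugate_iff]
    push_cast
    refine ⟨by rw [lt_div_iff₀ hm']; linarith, ?_⟩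
    field_simp
  have key := Real.inner_le_Lp_mul_Lq_of_nonneg (Finset.univ : Finset (ι × ι))
    (f := fun x => w x.1 x.2 ^ ((m : ℝ) / (m + n : ℕ)) * d x.1 ^ m)
    (g := fun x => w x.1 x.2 ^ ((n : ℝ) / (m + n : ℕ)) * e x.2 ^ n) hpq
    (fun x _ => mul_nonneg (Real.rpow_nonneg (hw _ _) _) (pow_nonneg (hd _) _))
    (fun x _ => mul_nonneg (Real.rpow_nonneg (hw _ _) _) (pow_nonneg (he _) _))
  have hpow : ∀ (u v : ℝ) (l : ℕ), 0 < l → 0 ≤ u → 0 ≤ v →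
      (u ^ ((l : ℝ) / (m + n : ℕ)) * v ^ l) ^ (((m + n : ℕ) : ℝ) / l) = u * v ^ (m + n) := by
    intro u v l hl hu hv
    have hl' : (0 : ℝ) < l := by exact_mod_cast hl
    rw [Real.mul_rpow (Real.rpow_nonneg hu _) (pow_nonneg hv _), ← Real.rpow_mul hu,
      ← Real.rpow_natCast v l, ← Real.rpow_mul hv, ← Real.rpow_natCast v (m + n)]
    congr 2
    · rw [show (l : ℝ) / (m + n : ℕ) * ((m + n : ℕ) / l) = 1 by field_simp, Real.rpow_one]
    · field_simp
  have hsplit : ∀ u : ℝ, 0 ≤ u →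
      u ^ ((m : ℝ) / (m + n : ℕ)) * u ^ ((n : ℝ) / (m + n : ℕ)) = u := by
    intro u hu
    rw [← Real.rpow_add_of_nonneg hu (by positivity) (by positivity), ← add_div, ← Nat.cast_add,
      div_self hL.ne', Real.rpow_one]
  have hl : ∑ x : ι × ι, (w x.1 x.2 ^ ((m : ℝ) / (m + n : ℕ)) * d x.1 ^ m) *
      (w x.1 x.2 ^ ((n : ℝ) / (m + n : ℕ)) * e x.2 ^ n) =
      ∑ i, ∑ j, w i j * d i ^ m * e j ^ n := by
    rw [Fintype.sum_prod_type]
    refine Finset.sum_congr rfl fun i _ => Finset.sum_congr rfl fun j _ => ?_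
    conv_rhs => rw [← hsplit _ (hw i j)]
    ring
  have hf : ∑ x : ι × ι, (w x.1 x.2 ^ ((m : ℝ) / (m + n : ℕ)) * d x.1 ^ m) ^
      (((m + n : ℕ) : ℝ) / m) = ∑ i, d i ^ (m + n) := by
    rw [Fintype.sum_prod_type]
    refine Finset.sum_congr rfl fun i _ => ?_
    simp only [hpow _ _ m hm (hw _ _) (hd _)]
    rw [← Finset.sum_mul, hrow, one_mul]
  have hg : ∑ x : ι × ι, (w x.1 x.2 ^ ((n : ℝ) / (m + n : ℕ)) * e x.2 ^ n) ^
      (((m + n : ℕ) : ℝ) / n) = ∑ j, e j ^ (m + n) := by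
    rw [Fintype.sum_prod_type_right]
    refine Finset.sum_congr rfl fun j _ => ?_
    simp only [hpow _ _ n hn (hw _ _) (he _)]
    rw [← Finset.sum_mul, hcol, one_mul]
  rw [hl, hf, hg, one_div_div, one_div_div] at key
  exact key

variable {ι : Type*} [Fintype ι] [DecidableEq ι]

/-- Orthogonal diagonalization of a real positive semidefinite matrix. -/
lemma exists_orthogonal_diagonalization {A : Matrix ι ι ℝ} (hA : A.PosSemidef) :
    ∃ (U : Matrix ι ι ℝ) (d : ι → ℝ), Uᵀ * U = 1 ∧ U * Uᵀ = 1 ∧ (∀ i, 0 ≤ d i) ∧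
      ∀ m : ℕ, A ^ m = U * diagonal (fun i => d i ^ m) * Uᵀ := by
  have hUU : ((hA.1.eigenvectorUnitary : Matrix ι ι ℝ))ᵀ * hA.1.eigenvectorUnitary = 1 := by
    simpa [star_eq_conjTranspose] using Unitary.coe_star_mul_self hA.1.eigenvectorUnitary
  have hUU' : (hA.1.eigenvectorUnitary : Matrix ι ι ℝ) * (hA.1.eigenvectorUnitary)ᵀ = 1 := by
    simpa [star_eq_conjTranspose] using Unitary.coe_mul_star_self hA.1.eigenvectorUnitary
  have hspec : A = (hA.1.eigenvectorUnitary : Matrix ι ι ℝ) * diagonal hA.1.eigenvalues *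
      (hA.1.eigenvectorUnitary : Matrix ι ι ℝ)ᵀ := by
    have h := hA.1.spectral_theorem
    rw [Unitary.conjStarAlgAut_apply] at h
    exact h
  have hnonneg := hA.eigenvalues_nonneg
  generalize (hA.1.eigenvectorUnitary : Matrix ι ι ℝ) = U at hUU hUU' hspec
  generalize hA.1.eigenvalues = d at hspec hnonneg
  refine ⟨U, d, hUU, hUU', hnonneg, fun m => ?_⟩
  induction m with
  | zero => simp [hUU']
  | succ m ih =>
    rw [pow_succ, ih]
    conv_lhs => rw [hspec]
    calc _ = U * diagonal (fun i => d i ^ m) * (Uᵀ * U) * diagonal d * Uᵀ := by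
          simp only [Matrix.mul_assoc]
      _ = _ := by
        rw [hUU, Matrix.mul_one, Matrix.mul_assoc U, diagonal_mul_diagonal]
        simp only [pow_succ]

/-- The trace Hölder inequality for powers of positive semidefinite matrices intertwined by a
symmetric orthogonal matrix. -/
lemma trace_pow_mul_pow_le {A B S : Matrix ι ι ℝ} (hA : A.PosSemidef) (hB : B.PosSemidef)
    (hS : Sᵀ = S) (hSS : S * S = 1) {m n : ℕ} (hm : 0 < m) (hn : 0 < n) :
    (A ^ m * S * B ^ n * S).trace ≤
      (A ^ (m + n)).trace ^ ((m : ℝ) / (m + n : ℕ)) *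
        (B ^ (m + n)).trace ^ ((n : ℝ) / (m + n : ℕ)) := by
  obtain ⟨U, d, hU, hU', hd, hAp⟩ := exists_orthogonal_diagonalization hA
  obtain ⟨V, e, hV, hV', he, hBp⟩ := exists_orthogonal_diagonalization hB
  have htr : ∀ (X : Matrix ι ι ℝ) (f : ι → ℝ), Xᵀ * X = 1 →
      (X * diagonal f * Xᵀ).trace = ∑ i, f i := by
    intro X f hX
    rw [Matrix.trace_mul_comm, ← Matrix.mul_assoc, hX, Matrix.one_mul, trace_diagonal]
  set W : Matrix ι ι ℝ := Uᵀ * S * V with hW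
  have hWt : Wᵀ = Vᵀ * S * U := by
    rw [hW, transpose_mul, transpose_mul, transpose_transpose, hS, Matrix.mul_assoc]
  have hWW : W * Wᵀ = 1 := by
    rw [hWt, hW]
    calc _ = Uᵀ * (S * (V * Vᵀ) * S) * U := by simp only [Matrix.mul_assoc]
      _ = 1 := by rw [hV', Matrix.mul_one, hSS, Matrix.mul_one, hU]
  have hWW' : Wᵀ * W = 1 := by
    rw [hWt, hW]
    calc _ = Vᵀ * (S * (U * Uᵀ) * S) * V := by simp only [Matrix.mul_assoc]
      _ = 1 := by rw [hU', Matrix.mul_one, hSS, Matrix.mul_one, hV]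
  have hlhs : (A ^ m * S * B ^ n * S).trace = ∑ i, ∑ j, W i j ^ 2 * d i ^ m * e j ^ n := by
    rw [hAp, hBp]
    calc _ = (U * (diagonal (fun i => d i ^ m) * W * diagonal (fun i => e i ^ n) * Vᵀ * S)).trace :=
          by rw [hW]; simp only [Matrix.mul_assoc]
      _ = (diagonal (fun i => d i ^ m) * W * diagonal (fun i => e i ^ n) * Wᵀ).trace := by
          rw [Matrix.trace_mul_comm, hWt]; simp only [Matrix.mul_assoc]
      _ = _ := by
          simp only [Matrix.trace, Matrix.diag_apply]
          refine Finset.sum_congr rfl fun i _ => ?_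
          rw [Matrix.mul_apply]
          refine Finset.sum_congr rfl fun j _ => ?_
          rw [mul_diagonal, diagonal_mul, transpose_apply]
          ring
  rw [hlhs, hAp, hBp, htr _ _ hU, htr _ _ hV]
  refine sum_mul_pow_mul_pow_le (fun i j => W i j ^ 2) (fun _ _ => sq_nonneg _) (fun i => ?_)
    (fun j => ?_) d e hd he hm hn
  · have h := congrFun (congrFun hWW i) i
    simpa [Matrix.mul_apply, sq] using h
  · have h := congrFun (congrFun hWW' j) j
    simpa [Matrix.mul_apply, sq] using h

/-- A real-number estimate on the two mixed Hölder bounds for a decomposition of unity. -/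
lemma holder_pair_div_le {α β θ : ℝ} (hα : 0 ≤ α) (hβ : 0 ≤ β) (hZ : 0 < α + β)
    (hθ : 0 < θ) (hθ' : θ ≤ 1 / 2) :
    (α ^ (1 - θ) * β ^ θ + β ^ (1 - θ) * α ^ θ) / (α + β) ≤ 2 * (β / (α + β)) ^ θ := by
  have hx : 0 ≤ β / (α + β) := by positivity
  have hx1 : β / (α + β) ≤ 1 := by rw [div_le_one hZ]; linarith
  have hy : 0 ≤ α / (α + β) := by positivity
  have hy1 : α / (α + β) ≤ 1 := by rw [div_le_one hZ]; linarith
  have hsplit : ∀ u v : ℝ, 0 ≤ u → 0 ≤ v → u ^ (1 - θ) * v ^ θ / (α + β) =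
      (u / (α + β)) ^ (1 - θ) * (v / (α + β)) ^ θ := by
    intro u v hu hv
    rw [Real.div_rpow hu hZ.le, Real.div_rpow hv hZ.le, div_mul_div_comm,
      ← Real.rpow_add hZ, sub_add_cancel, Real.rpow_one]
  rw [add_div, hsplit _ _ hα hβ, hsplit _ _ hβ hα]
  have h1 : (α / (α + β)) ^ (1 - θ) * (β / (α + β)) ^ θ ≤ (β / (α + β)) ^ θ :=
    mul_le_of_le_one_left (Real.rpow_nonneg hx _) (Real.rpow_le_one hy hy1 (by linarith))
  have h2 : (β / (α + β)) ^ (1 - θ) * (α / (α + β)) ^ θ ≤ (β / (α + β)) ^ θ :=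
    (mul_le_of_le_one_right (Real.rpow_nonneg hx _) (Real.rpow_le_one hy hy1 hθ.le)).trans
      (Real.rpow_le_rpow_of_exponent_ge_of_imp hx hx1 (by linarith) (by intro _ h; linarith))
  linarith

/-- The Tomboulis–Yaffe bound for an abstract positive transfer matrix `T` with a reflection
symmetry `P` and an insertion `S` that is odd under `P`. -/
theorem trace_insertion_le {T P S : Matrix ι ι ℝ} (hT : T.PosSemidef) (hP : Pᵀ = P)
    (hPP : P * P = 1) (hTP : T * P = P * T) (hS : Sᵀ = S) (hSS : S * S = 1)
    (hSP : S * P = -(P * S)) {m n : ℕ} (hn : 0 < n) (hnm : n ≤ m)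
    (hZ : 0 < (T ^ (m + n)).trace) :
    (T ^ m * S * T ^ n * S).trace / (T ^ (m + n)).trace ≤
      2 * ((2 : ℝ)⁻¹ * (1 - (T ^ (m + n) * P).trace / (T ^ (m + n)).trace)) ^
        ((n : ℝ) / (m + n : ℕ)) := by
  have hm : 0 < m := hn.trans_le hnm
  set E : Matrix ι ι ℝ := (2 : ℝ)⁻¹ • (1 + P) with hE
  set O : Matrix ι ι ℝ := (2 : ℝ)⁻¹ • (1 - P) with hO
  have hsum : E + O = 1 := by rw [hE, hO]; module
  have hEE : E * E = E := by
    rw [hE]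
    simp only [smul_mul_smul_comm, Matrix.mul_add, Matrix.add_mul, hPP, Matrix.mul_one,
      Matrix.one_mul]
    module
  have hOO : O * O = O := by
    rw [hO]
    simp only [smul_mul_smul_comm, Matrix.mul_sub, Matrix.sub_mul, hPP, Matrix.mul_one,
      Matrix.one_mul]
    module
  have hEO : E * O = 0 := by
    rw [hE, hO]
    simp only [smul_mul_smul_comm, Matrix.mul_sub, Matrix.add_mul, hPP, Matrix.mul_one,
      Matrix.one_mul]
    module
  have hOE : O * E = 0 := by
    rw [hE, hO]
    simp only [smul_mul_smul_comm, Matrix.mul_add, Matrix.sub_mul, hPP, Matrix.mul_one,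
      Matrix.one_mul]
    module
  have hTE : Commute T E := by
    rw [hE, Commute, SemiconjBy]
    simp [Matrix.mul_add, Matrix.add_mul, hTP]
  have hTO : Commute T O := by
    rw [hO, Commute, SemiconjBy]
    simp [Matrix.mul_sub, Matrix.sub_mul, hTP]
  have hES : S * E = O * S := by
    rw [hE, hO]
    simp [Matrix.mul_add, hSP, sub_eq_add_neg, Matrix.add_mul]
  have hOS : S * O = E * S := by
    rw [hE, hO]
    simp [Matrix.mul_sub, Matrix.add_mul, hSP]
  have hEt : Eᴴ = E := by
    rw [hE]; simp [conjTranspose_eq_transpose_of_trivial, hP]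
  have hOt : Oᴴ = O := by
    rw [hO]; simp [conjTranspose_eq_transpose_of_trivial, hP]
  have hA : (T * E).PosSemidef := by
    have h := hT.conjTranspose_mul_mul_same E
    rwa [hEt, ← hTE.eq, Matrix.mul_assoc, hEE] at h
  have hB : (T * O).PosSemidef := by
    have h := hT.conjTranspose_mul_mul_same O
    rwa [hOt, ← hTO.eq, Matrix.mul_assoc, hOO] at h
  have hpow : ∀ Q : Matrix ι ι ℝ, Commute T Q → Q * Q = Q → ∀ l : ℕ, 0 < l →
      (T * Q) ^ l = T ^ l * Q := by
    intro Q hc hQ l hl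
    rw [hc.mul_pow, IsIdempotentElem.pow_eq hQ hl.ne']
  have hEp : ∀ l : ℕ, 0 < l → (T * E) ^ l = T ^ l * E := hpow E hTE hEE
  have hOp : ∀ l : ℕ, 0 < l → (T * O) ^ l = T ^ l * O := hpow O hTO hOO
  have hmn : 0 < m + n := by omega
  have hnum : (T ^ m * S * T ^ n * S).trace =
      ((T * E) ^ m * S * (T * O) ^ n * S).trace + ((T * O) ^ m * S * (T * E) ^ n * S).trace := by
    rw [← trace_add, hEp m hm, hOp m hm, hEp n hn, hOp n hn]
    congr 1
    have h1 : T ^ m * E * S * (T ^ n * O) * S = T ^ m * S * T ^ n * O * S := by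
      calc _ = T ^ m * (E * S) * (T ^ n * O) * S := by simp only [Matrix.mul_assoc]
        _ = T ^ m * S * (O * T ^ n) * O * S := by rw [← hOS]; simp only [Matrix.mul_assoc]
        _ = T ^ m * S * T ^ n * (O * O) * S := by
            rw [← (hTO.pow_left n).eq]; simp only [Matrix.mul_assoc]
        _ = _ := by rw [hOO]
    have h2 : T ^ m * O * S * (T ^ n * E) * S = T ^ m * S * T ^ n * E * S := by
      calc _ = T ^ m * (O * S) * (T ^ n * E) * S := by simp only [Matrix.mul_assoc]
        _ = T ^ m * S * (E * T ^ n) * E * S := by rw [← hES]; simp only [Matrix.mul_assoc]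
        _ = T ^ m * S * T ^ n * (E * E) * S := by
            rw [← (hTE.pow_left n).eq]; simp only [Matrix.mul_assoc]
        _ = _ := by rw [hEE]
    rw [h1, h2, ← Matrix.add_mul, ← Matrix.mul_add, add_comm O E, hsum, Matrix.mul_one]
  have hα : 0 ≤ ((T * E) ^ (m + n)).trace := (hA.pow _).trace_nonneg
  have hβ : 0 ≤ ((T * O) ^ (m + n)).trace := (hB.pow _).trace_nonneg
  have hZeq : (T ^ (m + n)).trace = ((T * E) ^ (m + n)).trace + ((T * O) ^ (m + n)).trace := by
    rw [hEp _ hmn, hOp _ hmn, ← trace_add, ← Matrix.mul_add, hsum, Matrix.mul_one]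
  have hpar : (2 : ℝ)⁻¹ * (1 - (T ^ (m + n) * P).trace / (T ^ (m + n)).trace) =
      ((T * O) ^ (m + n)).trace / (T ^ (m + n)).trace := by
    rw [hOp _ hmn, hO, Matrix.mul_smul, trace_smul, Matrix.mul_sub, Matrix.mul_one, trace_sub,
      smul_eq_mul]
    field_simp
  have hm' : (m : ℝ) / (m + n : ℕ) = 1 - (n : ℝ) / (m + n : ℕ) := by
    have : ((m + n : ℕ) : ℝ) ≠ 0 := by exact_mod_cast hmn.ne'
    field_simp
    push_cast
    ring
  have b1 := trace_pow_mul_pow_le hA hB hS hSS hm hn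
  have b2 := trace_pow_mul_pow_le hB hA hS hSS hm hn
  rw [hm'] at b1 b2
  rw [hpar, hnum]
  rw [hZeq] at hZ ⊢
  refine le_trans (div_le_div_of_nonneg_right (add_le_add b1 b2) hZ.le)
    (holder_pair_div_le hα hβ hZ ?_ ?_)
  · have : (0 : ℝ) < n := by exact_mod_cast hn
    positivity
  · have h0 : (0 : ℝ) < (m + n : ℕ) := by exact_mod_cast hmn
    rw [div_le_iff₀ h0]
    have : (n : ℝ) ≤ m := by exact_mod_cast hnm
    push_cast
    linarith

end MatrixInequalities

section TransferMatrix

variable {ι : Type*} [Fintype ι] [DecidableEq ι]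

/-- Path expansion of an ordered product of matrices. -/
lemma sum_path_eq (N : ℕ) (M : ℕ → Matrix ι ι ℝ) (h : ι → ι → ℝ) :
    ∑ σ : Fin (N + 1) → ι, h (σ 0) (σ (Fin.last N)) *
        ∏ i : Fin N, M i (σ i.castSucc) (σ i.succ) =
      ∑ x, ∑ y, h x y * ((List.range N).map M).prod x y := by
  induction N generalizing M h with
  | zero =>
    rw [← (Equiv.funUnique (Fin 1) ι).symm.sum_comp]
    simp [Matrix.one_apply]
  | succ N ih =>
    rw [← (Fin.consEquiv fun _ : Fin (N + 2) => ι).sum_comp, Fintype.sum_prod_type,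
      Finset.sum_comm]
    have hstep : ∀ τ : Fin (N + 1) → ι, ∑ x, h (Fin.cons (α := fun _ => ι) x τ 0)
          (Fin.cons (α := fun _ => ι) x τ (Fin.last (N + 1))) *
        ∏ i : Fin (N + 1), M i (Fin.cons (α := fun _ => ι) x τ i.castSucc)
          (Fin.cons (α := fun _ => ι) x τ i.succ) =
        (fun z y => ∑ x, h x y * M 0 x z) (τ 0) (τ (Fin.last N)) *
          ∏ i : Fin N, M (i + 1) (τ i.castSucc) (τ i.succ) := by
      intro τ
      simp only [Finset.sum_mul]
      refine Finset.sum_congr rfl fun x _ => ?_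
      rw [Fin.prod_univ_succ, ← Fin.succ_last]
      simp only [Fin.cons_succ, Fin.cons_zero, Fin.castSucc_zero, Fin.val_zero, Fin.val_succ,
        ← Fin.succ_castSucc]
      ring
    refine (Finset.sum_congr rfl fun τ _ => hstep τ).trans ?_
    rw [ih (fun i => M (i + 1)) fun z y => ∑ x, h x y * M 0 x z, List.range_succ_eq_map]
    simp only [List.map_cons, List.map_map, List.prod_cons, Matrix.mul_apply, Finset.sum_mul,
      Finset.mul_sum]
    have hcomp : M ∘ Nat.succ = fun i => M (i + 1) := rfl
    rw [hcomp]
    calc _ = ∑ z, ∑ x, ∑ y, h x y * M 0 x z * ((List.range N).map fun i => M (i + 1)).prod z y :=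
          Finset.sum_congr rfl fun z _ => Finset.sum_comm
      _ = ∑ x, ∑ z, ∑ y, h x y * M 0 x z * ((List.range N).map fun i => M (i + 1)).prod z y :=
          Finset.sum_comm
      _ = _ := Finset.sum_congr rfl fun x _ => by
          rw [Finset.sum_comm]
          simp only [mul_assoc]

/-- Cyclic path expansion of the trace of an ordered product of matrices. -/
lemma trace_prod_eq_sum {L : ℕ} (hL : 0 < L) (M : ℕ → Matrix ι ι ℝ) :
    ∑ σ : Fin L → ι, ∏ i : Fin L, M i (σ i) (σ (cyc i 1)) =
      (((List.range L).map M).prod).trace := by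
  obtain ⟨N, rfl⟩ := Nat.exists_eq_succ_of_ne_zero hL.ne'
  have hlast : cyc (Fin.last N) 1 = 0 := by
    ext; simp [cyc]
  have hcast : ∀ i : Fin N, cyc i.castSucc 1 = i.succ := by
    intro i
    ext
    simp [cyc]
  rw [List.range_succ, List.map_append, List.prod_append]
  simp only [Nat.succ_eq_add_one, List.map_cons, List.map_nil, List.prod_singleton]
  rw [Matrix.trace_mul_comm]
  simp only [Matrix.trace, Matrix.diag_apply, Matrix.mul_apply]
  rw [Finset.sum_comm, ← sum_path_eq N M fun x y => M N y x]
  refine Finset.sum_congr rfl fun σ _ => ?_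
  rw [Fin.prod_univ_castSucc, hlast, mul_comm]
  simp only [hcast, Fin.val_castSucc, Fin.val_last]

/-- An ordered product with a constant tail. -/
lemma prod_range_add_of_eq (M : ℕ → Matrix ι ι ℝ) (T : Matrix ι ι ℝ) (r m : ℕ)
    (h : ∀ i, r ≤ i → i < r + m → M i = T) :
    ((List.range (r + m)).map M).prod = ((List.range r).map M).prod * T ^ m := by
  induction m with
  | zero => simp
  | succ m ih =>
    rw [← add_assoc, List.range_succ, List.map_append, List.prod_append,
      ih fun i h1 h2 => h i h1 (by omega), pow_succ, ← Matrix.mul_assoc]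
    simp [h (r + m) (by omega) (by omega)]

end TransferMatrix

section Ising

lemma spinv_not (s : Bool) : spinv (!s) = -spinv s := by cases s <;> simp [spinv]

lemma spinv_mul_self (s : Bool) : spinv s * spinv s = 1 := by cases s <;> simp [spinv]

/-- Energy of a column of spins. -/
noncomputable def columnEnergy (L2 : ℕ) (b : ℝ) (s : Fin L2 → Bool) : ℝ :=
  ∑ j, b * spinv (s j) * spinv (s (cyc j 1))

/-- Symmetrized transfer matrix between columns, with horizontal coupling `c`. -/
noncomputable def transfer (L2 : ℕ) (c b : ℝ) : Matrix (Fin L2 → Bool) (Fin L2 → Bool) ℝ :=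
  of fun s t => Real.exp (columnEnergy L2 b s / 2 + ∑ j, c * spinv (s j) * spinv (t j) +
    columnEnergy L2 b t / 2)

/-- The global spin flip on a column. -/
def flipMatrix (L2 : ℕ) : Matrix (Fin L2 → Bool) (Fin L2 → Bool) ℝ :=
  of fun s t => if t = (fun j => !s j) then 1 else 0

/-- Multiplication by the spin at height `j`. -/
noncomputable def spinMatrix (L2 : ℕ) (j : Fin L2) :
    Matrix (Fin L2 → Bool) (Fin L2 → Bool) ℝ :=
  diagonal fun s => spinv (s j)

lemma eq_flip_comm {L2 : ℕ} (s t : Fin L2 → Bool) :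
    t = (fun j => !s j) ↔ s = fun j => !t j := by
  constructor <;> rintro rfl <;> simp

lemma flip_transpose (L2 : ℕ) : (flipMatrix L2)ᵀ = flipMatrix L2 := by
  ext s t
  simp only [flipMatrix, transpose_apply, of_apply, eq_flip_comm s t]

lemma mul_flip_apply {L2 : ℕ} (A : Matrix (Fin L2 → Bool) (Fin L2 → Bool) ℝ)
    (s t : Fin L2 → Bool) : (A * flipMatrix L2) s t = A s fun j => !t j := by
  simp only [Matrix.mul_apply, flipMatrix, of_apply, eq_flip_comm _ t]
  simp

lemma flip_mul_apply {L2 : ℕ} (A : Matrix (Fin L2 → Bool) (Fin L2 → Bool) ℝ)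
    (s t : Fin L2 → Bool) : (flipMatrix L2 * A) s t = A (fun j => !s j) t := by
  simp [Matrix.mul_apply, flipMatrix]

lemma flip_mul_flip (L2 : ℕ) : flipMatrix L2 * flipMatrix L2 = 1 := by
  ext s t
  rw [mul_flip_apply]
  simp [flipMatrix, Matrix.one_apply, funext_iff, eq_comm]

lemma columnEnergy_flip {L2 : ℕ} (b : ℝ) (s : Fin L2 → Bool) :
    columnEnergy L2 b (fun j => !s j) = columnEnergy L2 b s := by
  simp [columnEnergy, spinv_not]

lemma transfer_mul_flip (L2 : ℕ) (c b : ℝ) :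
    transfer L2 c b * flipMatrix L2 = transfer L2 (-c) b := by
  ext s t
  rw [mul_flip_apply]
  simp [transfer, columnEnergy_flip, spinv_not]

lemma flip_mul_transfer (L2 : ℕ) (c b : ℝ) :
    flipMatrix L2 * transfer L2 c b = transfer L2 (-c) b := by
  ext s t
  rw [flip_mul_apply]
  simp [transfer, columnEnergy_flip, spinv_not]

lemma spinMatrix_mul_self {L2 : ℕ} (j : Fin L2) : spinMatrix L2 j * spinMatrix L2 j = 1 := by
  simp [spinMatrix, spinv_mul_self]

lemma spinMatrix_mul_flip {L2 : ℕ} (j : Fin L2) :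
    spinMatrix L2 j * flipMatrix L2 = -(flipMatrix L2 * spinMatrix L2 j) := by
  ext s t
  simp only [spinMatrix, diagonal_mul, Matrix.neg_apply, mul_diagonal, flipMatrix, of_apply]
  split_ifs with h
  · simp [h, spinv_not]
  · simp

lemma exp_coupling (a : ℝ) (s t : Bool) :
    Real.exp (a * spinv s * spinv t) = Real.cosh a + Real.sinh a * (spinv s * spinv t) := by
  cases s <;> cases t <;> simp [spinv, Real.cosh_add_sinh, ← sub_eq_add_neg, Real.cosh_sub_sinh]

/-- Positivity of the transfer matrix, from the character expansion of the coupling. -/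
lemma transfer_posSemidef (L2 : ℕ) {a : ℝ} (ha : 0 ≤ a) (b : ℝ) :
    (transfer L2 a b).PosSemidef := by
  let φ : Finset (Fin L2) → (Fin L2 → Bool) → ℝ := fun X s =>
    Real.exp (columnEnergy L2 b s / 2) * ∏ j ∈ X, spinv (s j)
  have h : transfer L2 a b = ∑ X : Finset (Fin L2),
      ((∏ _j ∈ X, Real.sinh a) * ∏ _j ∈ Xᶜ, Real.cosh a) • vecMulVec (φ X) (star (φ X)) := by
    ext s t
    rw [Matrix.sum_apply]
    simp only [transfer, of_apply, Real.exp_add, Real.exp_sum, exp_coupling,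
      add_comm (Real.cosh a), Fintype.prod_add, Finset.prod_mul_distrib, Finset.mul_sum,
      Finset.sum_mul, Matrix.smul_apply, vecMulVec_apply, φ, star_trivial, smul_eq_mul]
    refine Finset.sum_congr rfl fun X _ => ?_
    ring
  rw [h]
  refine posSemidef_sum _ fun X _ => (posSemidef_vecMulVec_self_star _).smul ?_
  exact mul_nonneg (Finset.prod_nonneg fun _ _ => Real.sinh_nonneg_iff.2 ha)
    (Finset.prod_nonneg fun _ _ => (Real.cosh_pos a).le)

lemma sum_cyc {L : ℕ} (hL : 0 < L) (f : Fin L → ℝ) : ∑ i, f (cyc i 1) = ∑ i, f i := by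
  obtain ⟨N, rfl⟩ := Nat.exists_eq_succ_of_ne_zero hL.ne'
  have h : ∀ i : Fin (N + 1), cyc i 1 = Equiv.addRight 1 i := by
    intro i
    ext
    simp [cyc, Fin.val_add]
  simp only [Nat.succ_eq_add_one, h]
  exact Equiv.sum_comp (Equiv.addRight (1 : Fin (N + 1))) f

/-- The Gibbs weight as a product of transfer matrix elements. -/
lemma exp_energy_eq_prod {L1 L2 : ℕ} (hL : 0 < L1) (J : Fin L1 → ℝ) (b : ℝ)
    (σ : Fin L1 × Fin L2 → Bool) :
    Real.exp (∑ x : Fin L1 × Fin L2, (J x.1 * spinv (σ x) * spinv (σ (cyc x.1 1, x.2)) +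
        b * spinv (σ x) * spinv (σ (x.1, cyc x.2 1)))) =
      ∏ i, transfer L2 (J i) b (fun j => σ (i, j)) (fun j => σ (cyc i 1, j)) := by
  simp only [transfer, of_apply]
  rw [← Real.exp_sum, Fintype.sum_prod_type]
  congr 1
  simp only [Finset.sum_add_distrib]
  rw [sum_cyc hL fun i => columnEnergy L2 b (fun j => σ (i, j)) / 2, ← Finset.sum_div]
  simp only [columnEnergy]
  ring

lemma ZI_eq_trace {L1 L2 : ℕ} (hL : 0 < L1) (a b : ℝ) :
    ZI L1 L2 a b = (2 : ℝ)⁻¹ ^ (L1 * L2) * (transfer L2 a b ^ L1).trace := by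
  rw [ZI, ← Finset.mul_sum]
  congr 1
  have h := trace_prod_eq_sum hL fun _ => transfer L2 a b
  rw [List.map_const', List.prod_replicate, List.length_range] at h
  rw [← h, ← (Equiv.curry (Fin L1) (Fin L2) Bool).sum_comp]
  exact Finset.sum_congr rfl fun σ _ => exp_energy_eq_prod hL (fun _ => a) b σ

lemma ZIm_eq_trace {L1 L2 : ℕ} (hL : 0 < L1) (a b : ℝ) :
    ZIm L1 L2 a b =
      (2 : ℝ)⁻¹ ^ (L1 * L2) * (transfer L2 a b ^ L1 * flipMatrix L2).trace := by
  rw [ZIm, ← Finset.mul_sum]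
  congr 1
  have h := trace_prod_eq_sum hL fun i => transfer L2 (if i + 1 = L1 then -a else a) b
  have hprod : ((List.range L1).map fun i => transfer L2 (if i + 1 = L1 then -a else a) b).prod =
      transfer L2 a b ^ L1 * flipMatrix L2 := by
    obtain ⟨N, rfl⟩ := Nat.exists_eq_succ_of_ne_zero hL.ne'
    have h0 := prod_range_add_of_eq
      (fun i => transfer L2 (if i + 1 = N + 1 then -a else a) b) (transfer L2 a b) 0 N
      (fun i _ hi => by rw [if_neg (by omega)])
    rw [zero_add] at h0
    rw [Nat.succ_eq_add_one, List.range_succ, List.map_append, List.prod_append, h0]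
    simp [pow_succ, Matrix.mul_assoc, transfer_mul_flip]
  rw [← hprod, ← h, ← (Equiv.curry (Fin L1) (Fin L2) Bool).sum_comp]
  exact Finset.sum_congr rfl fun σ _ =>
    exp_energy_eq_prod hL (fun i => if i.val + 1 = L1 then -a else a) b σ

lemma corrI_eq_trace {L1 L2 m n : ℕ} (hn : 0 < n) (hm : 0 < m) (hL : L1 = m + n) (a b : ℝ)
    (h0 : 0 < L1) (hnL : n < L1) (j : Fin L2) :
    corrI L1 L2 a b (⟨0, h0⟩, j) (⟨n, hnL⟩, j) =
      (2 : ℝ)⁻¹ ^ (L1 * L2) * (transfer L2 a b ^ m * spinMatrix L2 j * transfer L2 a b ^ n *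
        spinMatrix L2 j).trace / ZI L1 L2 a b := by
  rw [corrI]
  congr 1
  simp only [mul_assoc ((2 : ℝ)⁻¹ ^ (L1 * L2))]
  rw [← Finset.mul_sum]
  congr 1
  set T := transfer L2 a b with hT
  set S := spinMatrix L2 j with hS
  let M : ℕ → Matrix (Fin L2 → Bool) (Fin L2 → Bool) ℝ :=
    fun i => if i = 0 ∨ i = n then S * T else T
  have h := trace_prod_eq_sum h0 M
  have hprod : ((List.range L1).map M).prod = S * T ^ n * S * T ^ m := by
    obtain ⟨n, rfl⟩ := Nat.exists_eq_succ_of_ne_zero hn.ne'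
    obtain ⟨m, rfl⟩ := Nat.exists_eq_succ_of_ne_zero hm.ne'
    have e1 := prod_range_add_of_eq M T (n + 2) m fun i h1 h2 => if_neg (by omega)
    have e2 := prod_range_add_of_eq M T 1 n fun i h1 h2 => if_neg (by omega)
    have hM0 : M 0 = S * T := if_pos (Or.inl rfl)
    have hMn : M (n + 1) = S * T := if_pos (Or.inr rfl)
    rw [hL, show m.succ + n.succ = n + 2 + m by omega, e1, List.range_succ, List.map_append,
      List.prod_append, add_comm n 1, e2]
    rw [add_comm] at hMn
    simp only [List.range_one, List.map_cons, List.map_nil, List.prod_singleton, hM0, hMn,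
      Nat.succ_eq_add_one, pow_succ' T, Matrix.mul_assoc]
  have htr : (T ^ m * S * T ^ n * S).trace = (((List.range L1).map M).prod).trace := by
    rw [hprod, Matrix.mul_assoc (T ^ m * S), Matrix.mul_assoc (T ^ m), Matrix.trace_mul_comm]
    simp only [Matrix.mul_assoc]
  rw [htr, ← h, ← (Equiv.curry (Fin L1) (Fin L2) Bool).sum_comp]
  refine Finset.sum_congr rfl fun σ _ => ?_
  rw [exp_energy_eq_prod h0 (fun _ => a) b σ]
  have hMi : ∀ (i : Fin L1) (s t : Fin L2 → Bool), M i s t =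
      ((if i = ⟨0, h0⟩ then spinv (s j) else 1) * (if i = ⟨n, hnL⟩ then spinv (s j) else 1)) *
        T s t := by
    intro i s t
    by_cases hi0 : i.val = 0
    · have hin : i.val ≠ n := by omega
      simp [M, hi0, Fin.ext_iff, hS, spinMatrix, hn.ne]
    · by_cases hin : i.val = n
      · simp [M, hin, Fin.ext_iff, hS, spinMatrix, hn.ne']
      · simp [M, hi0, hin, Fin.ext_iff]
  simp only [hMi, Finset.prod_mul_distrib, Finset.prod_ite_eq', Finset.mem_univ, if_true,
    Equiv.curry_apply, Function.curry_apply]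
  rfl

lemma transfer_trace_pos (L1 L2 : ℕ) (hL : 0 < L1) (a b : ℝ) :
    0 < (transfer L2 a b ^ L1).trace := by
  have h := ZI_eq_trace (L2 := L2) hL a b
  have hZ : 0 < ZI L1 L2 a b := Finset.sum_pos (fun σ _ => by positivity) Finset.univ_nonempty
  rw [h] at hZ
  exact pos_of_mul_pos_right hZ (by positivity)

end Ising

end TYIsing

namespace TYIsing

/-- **Tomboulis–Yaffe inequality for the 2D square-lattice Ising model.**
For ferromagnetic couplings `a, b > 0` and `L1 = 2^k n`, the two-point function of two
spins at distance `n` along the first lattice direction satisfies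
`⟨σ_{(0,0)} σ_{(n,0)}⟩_Λ ≤ 2 ((1/2)(1 − Z_Λ^{(−)}/Z_Λ))^{n/L1}`. -/
theorem tomboulis_yaffe_ising
    (L1 L2 n k : ℕ) (hk : 0 < k) (hn : 0 < n) (hL2 : 0 < L2) (hL1 : L1 = 2 ^ k * n)
    (h1 : 0 < L1) (a b : ℝ) (ha : 0 < a) (hb : 0 < b) :
    corrI L1 L2 a b (⟨0, h1⟩, ⟨0, hL2⟩) (⟨n % L1, Nat.mod_lt _ h1⟩, ⟨0, hL2⟩) ≤
      2 * ((2 : ℝ)⁻¹ * (1 - ZIm L1 L2 a b / ZI L1 L2 a b)) ^ ((n : ℝ) / (L1 : ℝ)) := by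
  have hnm : n ≤ (2 ^ k - 1) * n := Nat.le_mul_of_pos_left n (by
    have := Nat.one_lt_two_pow hk.ne'
    omega)
  have hsum : L1 = (2 ^ k - 1) * n + n := by
    rw [hL1]
    nth_rewrite 3 [← one_mul n]
    rw [← add_mul, Nat.sub_add_cancel Nat.one_le_two_pow]
  generalize (2 ^ k - 1) * n = m at hnm hsum
  have hnL : n < L1 := by omega
  have hmod : (⟨n % L1, Nat.mod_lt _ h1⟩ : Fin L1) = ⟨n, hnL⟩ :=
    Fin.ext (Nat.mod_eq_of_lt hnL)
  have hpos := transfer_trace_pos L1 L2 h1 a b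
  rw [hmod, corrI_eq_trace hn (by omega) hsum, ZI_eq_trace h1, ZIm_eq_trace h1,
    mul_div_mul_left _ _ (by positivity), mul_div_mul_left _ _ (by positivity)]
  rw [hsum] at hpos ⊢
  exact trace_insertion_le (transfer_posSemidef L2 ha.le b) (flip_transpose L2)
    (flip_mul_flip L2) ((transfer_mul_flip L2 a b).trans (flip_mul_transfer L2 a b).symm)
    (Matrix.diagonal_transpose _) (spinMatrix_mul_self _) (spinMatrix_mul_flip _) hn hnm hpos

end TYIsing
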